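/- arXiv:math/0611525 — 2 statements merged into one kernel-verified Lean document; each statement's English description precedes it below -/
import Mathlib

section
/- Let S be a nonempty finite set, let A be a symmetric real S×S sub-generator (A_{x,y} ≥ 0 for x ≠ y and Σ_{y∈S} A_{x,y} ≤ 0 for all x), let B be its off-diagonal part, and set η_S = max{ max_{x∈S} Σ_{y∈S∖{x}} |B_{x,y}|, 1 }. Fix a ∈ S, T ≥ 1, and a Borel measurable function F : M_1(S) → ℝ, where M_1(S) = { μ ∈ [0,1]^S : Σ_{x∈S} μ_x = 1 }. For R ⊆ S and l ∈ M_T^+(R), let ext_S(l/T) ∈ M_1(S) be l/T on R and 0 on S∖R, and let ρ_{ab}^{(R)} denote the local-time density built from the submatrix A_{R×R}. Then Σ_{b∈S} Σ_{R : {a,b} ⊆ R ⊆ S} ∫_{M_T^+(R)} e^{T·F(ext_S(l/T))} ρ_{ab}^{(R)}(l) σ_T(dl) ≤ |S| · (η_S √(8e) T)^{|S|} · e^{|S|/(4T)} · exp( T · sup_{μ∈M_1(S)} [ F(μ) − Σ_{x,y∈S} √(μ_x)(−A_{x,y})√(μ_y) ] ), as an inequality in [0,∞]. -/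
open MeasureTheory Finset

noncomputable section

/-- The `(b,a)` cofactor of the `S × S` submatrix of `M`. -/
def cofDet {α : Type*} [Fintype α] [DecidableEq α]
    (S : Finset α) (M : Matrix α α ℂ) (a b : α) : ℂ :=
  (Matrix.of fun x y : S => if (x : α) = b then (if (y : α) = a then (1:ℂ) else 0)
    else (if (y : α) = a then 0 else M x y)).det

/-- Partial derivative in direction `x`. -/
def pd {α : Type*} [Fintype α] [DecidableEq α] (x : α) (f : (α → ℝ) → ℂ) :
    (α → ℝ) → ℂ :=
  fun l => fderiv ℝ f l (Pi.single x 1)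

/-- Mixed partial derivative `∂^Q f`. -/
def mpart {α : Type*} [Fintype α] [DecidableEq α] (Q : Finset α) (f : (α → ℝ) → ℂ) :
    (α → ℝ) → ℂ :=
  Q.toList.foldr pd f

/-- The differential operator `det_{ab}^{(α)}(M + ∂_l)` applied to `f` at `l`. -/
def ddet {α : Type*} [Fintype α] [DecidableEq α]
    (M : Matrix α α ℂ) (a b : α) (f : (α → ℝ) → ℂ) (l : α → ℝ) : ℂ :=
  ∑ Q ∈ ((Finset.univ : Finset α) \ {a, b}).powerset,
    cofDet ((Finset.univ : Finset α) \ Q) M a b * mpart Q f l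

/-- `G_M(l) = ∫_{[0,2π]^α} exp(Σ_{x,y} M_{x,y} √(l_x l_y) e^{i(θ_x−θ_y)}) ∏ dθ_x/(2π)`. -/
def GM {α : Type*} [Fintype α] [DecidableEq α] (M : Matrix α α ℝ) (l : α → ℝ) : ℂ :=
  ((2 * Real.pi : ℂ) ^ (Fintype.card α))⁻¹ *
    ∫ θ in Set.univ.pi (fun _ : α => Set.Icc (0:ℝ) (2 * Real.pi)),
      Complex.exp (∑ x, ∑ y, (M x y : ℂ) * (Real.sqrt (l x * l y) : ℂ) *
        Complex.exp (Complex.I * ((θ x : ℂ) - (θ y : ℂ))))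

/-- The local-time density `ρ_{ab}(l) = (det_{ab}(−A + ∂_l) G_A)(l)`. -/
def rho {α : Type*} [Fintype α] [DecidableEq α]
    (A : Matrix α α ℝ) (a b : α) (l : α → ℝ) : ℂ :=
  ddet ((-A).map (fun r => (r : ℂ))) a b (GM A) l

/-- The `σ_T` integral over the open simplex `M_T^+(α) = {l ∈ (0,∞)^α : Σ l_x = T}`,
parametrized by dropping the coordinate `a` (`ℝ≥0∞`-valued version). -/
def sigmaLInt {α : Type*} [Fintype α] [DecidableEq α] (a : α) (T : ℝ)
    (h : (α → ℝ) → ENNReal) : ENNReal :=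
  ∫⁻ t in {t : {x : α // x ≠ a} → ℝ | (∀ x, 0 < t x) ∧ ∑ x, t x < T},
    h (fun x => if hx : x = a then T - ∑ y, t y else t ⟨x, hx⟩)

theorem det_row_bound {α : Type*} [Fintype α] [DecidableEq α] (M : Matrix α α ℂ) :
    ‖M.det‖ ≤ ∏ x, ∑ y, ‖M x y‖ := by
  rw [← Matrix.det_transpose, Matrix.det_apply]
  calc _ ≤ ∑ σ : Equiv.Perm α, ∏ x, ‖M x (σ x)‖ := by
        refine (norm_sum_le _ _).trans (Finset.sum_le_sum fun σ _ => ?_)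
        rcases Int.units_eq_one_or (Equiv.Perm.sign σ) with h | h <;> simp [h, Matrix.transpose_apply]
    _ ≤ ∑ f : α → α, ∏ x, ‖M x (f x)‖ := by
        have := Finset.sum_image (s := (Finset.univ : Finset (Equiv.Perm α))) (g := fun σ : Equiv.Perm α => (σ : α → α)) (f := fun f : α → α => ∏ x, ‖M x (f x)‖) (fun a _ b _ h => DFunLike.coe_injective h)
        rw [← this]
        exact Finset.sum_le_sum_of_subset_of_nonneg (Finset.subset_univ _) (fun _ _ _ => Finset.prod_nonneg fun _ _ => norm_nonneg _)
    _ = _ := by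
        rw [Finset.prod_univ_sum]; simp

theorem circ_indep (f : ℂ → ℂ) (hf : ∀ z, z ≠ 0 → DifferentiableAt ℂ f z) {r R : ℝ} (hr : 0 < r) (hR : 0 < R) :
    ∫ t in Set.Icc (0:ℝ) (2 * Real.pi), f (r * Complex.exp (Complex.I * t)) =
    ∫ t in Set.Icc (0:ℝ) (2 * Real.pi), f (R * Complex.exp (Complex.I * t)) := by
  wlog h : r ≤ R generalizing r R
  · exact (this hR hr (le_of_not_ge h)).symm
  have key := Complex.circleIntegral_sub_center_inv_smul_eq_of_differentiable_on_annulus_off_countable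
    (c := 0) hr h (f := f) (s := ∅) Set.countable_empty
    (fun z hz => (hf z (by rintro rfl; simp [hr] at hz)).continuousAt.continuousWithinAt)
    (fun z hz => hf z (by rintro rfl; simp [hr.le] at hz))
  have h1 := Real.circleAverage_eq_circleIntegral (c := 0) (f := f) hr.ne'
  have h2 := Real.circleAverage_eq_circleIntegral (c := 0) (f := f) hR.ne'
  rw [key, ← h1] at h2
  unfold Real.circleAverage at h2
  have h3 := smul_right_injective ℂ (inv_ne_zero Real.two_pi_pos.ne') h2
  simp only [circleMap, zero_add, intervalIntegral.integral_of_le Real.two_pi_pos.le] at h3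
  simp only [integral_Icc_eq_integral_Ioc, mul_comm Complex.I]
  exact h3.symm

theorem fubini_coord {α : Type*} [Fintype α] [DecidableEq α] (x : α) (μ : Measure ℝ) [IsFiniteMeasure μ]
    (f : (α → ℝ) → ℂ) (hf : Integrable f (Measure.pi fun _ => μ)) :
    ∫ θ, f θ ∂(Measure.pi fun _ : α => μ) =
    ∫ θ' : {y // ¬ y = x} → ℝ, ∫ t, f (fun y => if h : y = x then t else θ' ⟨y, h⟩) ∂μ ∂(Measure.pi fun _ => μ) := by
  have e1 := (measurePreserving_piEquivPiSubtypeProd (fun _ : α => μ) (· = x)).symm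
  have e2 := (@measurePreserving_piUnique {y // y = x} (Subtype.fintype fun y => y = x) _ _ _ (fun _ => μ)).symm
  have e3 := e1.comp (e2.prod (MeasurePreserving.id (Measure.pi fun _ : {y // ¬ y = x} => μ)))
  let E := (((MeasurableEquiv.piUnique (fun _ : {y // y = x} => ℝ)).symm.prodCongr (MeasurableEquiv.refl ({y // ¬ y = x} → ℝ)))).trans (MeasurableEquiv.piEquivPiSubtypeProd (fun _ : α => ℝ) (· = x)).symm
  have e4 : MeasurePreserving E (μ.prod (Measure.pi fun _ => μ)) (Measure.pi fun _ => μ) := e3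
  rw [← e4.integral_comp' f, integral_prod_symm]
  · rfl
  · exact (e4.integrable_comp_emb E.measurableEmbedding).2 hf

/-- the angular box -/
def tbox (α : Type*) : Set (α → ℝ) := Set.univ.pi (fun _ : α => Set.Icc (0:ℝ) (2 * Real.pi))

/-- unit vectors -/
def eu {α : Type*} (θ : α → ℝ) (x : α) : ℂ := Complex.exp (Complex.I * θ x)

theorem tbox_compact (α : Type*) : IsCompact (tbox α) := isCompact_univ_pi fun _ => isCompact_Icc

theorem gauge_step {α : Type*} [Fintype α] [DecidableEq α] (Φ : (α → ℂ) → ℂ)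
    (hΦ : ∀ w : α → ℂ, (∀ x, w x ≠ 0) → DifferentiableAt ℂ Φ w) (x : α) (c c' : α → ℝ)
    (hc : ∀ y, 0 < c y) (hc' : ∀ y, 0 < c' y) (hcc : ∀ y, y ≠ x → c y = c' y) :
    ∫ θ in tbox α, Φ (fun y => c y * eu θ y) = ∫ θ in tbox α, Φ (fun y => c' y * eu θ y) := by
  have h_int : ∀ c : α → ℝ, (∀ y, 0 < c y) → IntegrableOn (fun θ : α → ℝ => Φ (fun y => c y * eu θ y)) (tbox α) := by
    intro c hc
    apply ContinuousOn.integrableOn_compact (tbox_compact α)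
    apply Continuous.continuousOn
    rw [continuous_iff_continuousAt]
    intro θ
    have h1 : ContinuousAt Φ (fun y => c y * eu θ y) :=
      (hΦ _ (fun y => mul_ne_zero (by exact_mod_cast (hc y).ne') (Complex.exp_ne_zero _))).continuousAt
    have h2 : Continuous (fun (θ : α → ℝ) (y : α) => (c y : ℂ) * eu θ y) := by
      unfold eu; fun_prop
    exact ContinuousAt.comp (g := Φ) (f := fun (θ : α → ℝ) (y : α) => (c y : ℂ) * eu θ y) h1 h2.continuousAt
  have h1 := h_int c hc
  have h2 := h_int c' hc'
  unfold IntegrableOn tbox at h1 h2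
  unfold tbox
  rw [volume_pi, Measure.restrict_pi_pi] at *
  rw [fubini_coord x _ _ h1, fubini_coord x _ _ h2]
  congr 1
  funext θ'
  let f : ℂ → ℂ := fun z => Φ (fun y => if h : y = x then z else c y * Complex.exp (Complex.I * θ' ⟨y, h⟩))
  have hf : ∀ z, z ≠ 0 → DifferentiableAt ℂ f z := by
    intro z hz
    have h3 : DifferentiableAt ℂ (fun (z : ℂ) (y : α) => if h : y = x then z else c y * Complex.exp (Complex.I * θ' ⟨y, h⟩)) z := by
      rw [differentiableAt_pi]
      intro y
      by_cases h : y = x <;> simp [h]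
    refine DifferentiableAt.comp z (g := Φ) (hΦ _ ?_) h3
    intro y
    by_cases h : y = x
    · simpa [h] using hz
    · simp [h, Complex.exp_ne_zero, (hc y).ne']
  have h4 := circ_indep f hf (hc x) (hc' x)
  have e1 : ∀ t : ℝ, Φ (fun y => c y * eu (fun y => if h : y = x then t else θ' ⟨y, h⟩) y) =
      f (c x * Complex.exp (Complex.I * t)) := by
    intro t
    simp only [f, eu]
    congr 1
    funext y
    by_cases h : y = x
    · subst h; simp
    · simp [h]
  have e2 : ∀ t : ℝ, Φ (fun y => c' y * eu (fun y => if h : y = x then t else θ' ⟨y, h⟩) y) =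
      f (c' x * Complex.exp (Complex.I * t)) := by
    intro t
    simp only [f, eu]
    congr 1
    funext y
    by_cases h : y = x
    · subst h; simp
    · simp [h, hcc y h]
  simp only [e1, e2]
  exact h4

theorem torus_gauge {α : Type*} [Fintype α] [DecidableEq α] (Φ : (α → ℂ) → ℂ)
    (hΦ : ∀ w : α → ℂ, (∀ x, w x ≠ 0) → DifferentiableAt ℂ Φ w) (c : α → ℝ)
    (hc : ∀ y, 0 < c y) :
    ∫ θ in tbox α, Φ (eu θ) = ∫ θ in tbox α, Φ (fun y => c y * eu θ y) := by
  have key : ∀ s : Finset α, ∫ θ in tbox α, Φ (eu θ) =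
      ∫ θ in tbox α, Φ (fun y => ((if y ∈ s then c y else 1 : ℝ) : ℂ) * eu θ y) := by
    intro s
    induction s using Finset.induction_on with
    | empty => simp
    | insert x s hx ih =>
      rw [ih]
      apply gauge_step Φ hΦ x
      · intro y; split_ifs <;> simp [hc]
      · intro y; split_ifs <;> simp [hc]
      · intro y hy; simp [hy]
  simpa using key Finset.univ

theorem det_expand {α : Type*} [Fintype α] [DecidableEq α] (N : Matrix α α ℂ) (D : α → ℂ) :
    (N + Matrix.diagonal D).det =
      ∑ Q : Finset α, (N.submatrix (fun x : (Finset.univ \ Q : Finset α) => (x : α))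
        (fun x : (Finset.univ \ Q : Finset α) => (x : α))).det * ∏ x ∈ Q, D x := by
  have h := (Matrix.detRowAlternating (n := α) (R := ℂ)).map_add_univ (Matrix.diagonal D) N
  rw [add_comm]
  refine h.trans (Finset.sum_congr rfl fun Q _ => ?_)
  let P : Matrix α α ℂ := Matrix.of fun i j => if i ∈ Q then Matrix.diagonal D i j else N i j
  have hP : Matrix.detRowAlternating (Q.piecewise (Matrix.diagonal D) N) = P.det := by
    change _ = Matrix.detRowAlternating P
    congr 1
    funext i j
    by_cases hi : i ∈ Q <;> simp [P, Finset.piecewise, hi]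
  rw [hP, Matrix.twoBlockTriangular_det' P (fun x => x ∈ Q), mul_comm]
  · have h1 : (Matrix.toSquareBlockProp P (fun x => ¬ x ∈ Q)) =
        (N.submatrix (fun x : (Finset.univ \ Q : Finset α) => (x : α))
          (fun x : (Finset.univ \ Q : Finset α) => (x : α))).submatrix
          (Equiv.subtypeEquivRight (p := fun x => ¬ x ∈ Q) (q := fun x => x ∈ Finset.univ \ Q)
            (fun x => by simp))
          (Equiv.subtypeEquivRight (p := fun x => ¬ x ∈ Q) (q := fun x => x ∈ Finset.univ \ Q)
            (fun x => by simp)) := by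
      ext i j
      have := i.2
      simp only [Matrix.toSquareBlockProp, P, Matrix.submatrix_apply, Matrix.of_apply, Matrix.toBlock_apply]
      rw [if_neg this]
      rfl
    rw [h1, Matrix.det_submatrix_equiv_self]
    congr 1
    · have : (Matrix.toSquareBlockProp P (fun x => x ∈ Q)) =
          Matrix.diagonal (fun x : {x // x ∈ Q} => D x) := by
        ext i j
        have hi := i.2
        by_cases hij : i = j
        · subst hij; simp [Matrix.toSquareBlockProp, P]
        · have h2 : (i : α) ≠ j := fun h => hij (Subtype.ext h)
          simp [Matrix.toSquareBlockProp, P, hij, h2]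
      rw [this]
      convert Matrix.det_diagonal
      rw [← Finset.prod_coe_sort Q D]
      apply Finset.prod_congr
      · ext; simp
      · simp
  · intro i hi j hj
    have : i ≠ j := by rintro rfl; exact hj hi
    simp [P, hi, Matrix.diagonal, this]

/-- The full cofactor matrix with extra diagonal part. -/
def cofMat {α : Type*} [Fintype α] [DecidableEq α] (M : Matrix α α ℂ) (a b : α) (D : α → ℂ) :
    Matrix α α ℂ :=
  (Matrix.of fun x y : α => if x = b then (if y = a then (1:ℂ) else 0)
    else (if y = a then 0 else M x y)) + Matrix.diagonal (fun x => if x = a ∨ x = b then 0 else D x)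

theorem cof_expand {α : Type*} [Fintype α] [DecidableEq α] (M : Matrix α α ℂ) (a b : α)
    (D : α → ℂ) :
    ∑ Q ∈ ((Finset.univ : Finset α) \ {a, b}).powerset,
      cofDet ((Finset.univ : Finset α) \ Q) M a b * ∏ x ∈ Q, D x = (cofMat M a b D).det := by
  unfold cofMat
  rw [det_expand]
  symm
  rw [← Finset.sum_subset (Finset.subset_univ ((Finset.univ : Finset α) \ {a, b}).powerset)]
  · refine Finset.sum_congr rfl fun Q hQ => ?_
    congr 1
    refine Finset.prod_congr rfl fun x hx => ?_
    have := Finset.mem_powerset.1 hQ hx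
    simp at this
    simp [this]
  · intro Q _ hQ
    rw [Finset.mem_powerset, Finset.not_subset] at hQ
    obtain ⟨x, hx, hx2⟩ := hQ
    have hx3 : x = a ∨ x = b := by simpa [-not_or, or_iff_not_imp_left] using hx2
    rw [Finset.prod_eq_zero hx (by simp [hx3]), mul_zero]

/-- linear form -/
def linForm {α : Type*} [Fintype α] (w : α → ℂ) : (α → ℝ) →L[ℝ] ℂ :=
  ∑ y, (w y) • (Complex.ofRealCLM ∘L (ContinuousLinearMap.proj (R := ℝ) (φ := fun _ : α => ℝ) y))

theorem linForm_apply {α : Type*} [Fintype α] (w : α → ℂ) (l : α → ℝ) :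
    linForm w l = ∑ y, (l y : ℂ) * w y := by
  simp [linForm, mul_comm]

theorem linForm_cont {α β : Type*} [Fintype α] [TopologicalSpace β] (w : β → α → ℂ)
    (hw : ∀ y, Continuous (fun b => w b y)) : Continuous (fun b => linForm (w b)) := by
  unfold linForm
  exact continuous_finsetSum _ fun y _ => (hw y).smul continuous_const

theorem param_deriv {α : Type*} [Fintype α] (F : (α → ℝ) → (α → ℝ) → ℂ)
    (F' : (α → ℝ) → (α → ℝ) → ((α → ℝ) →L[ℝ] ℂ)) (μ : Measure (α → ℝ)) (l : α → ℝ) (C : ℝ)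
    (hF1 : ∀ᶠ l in nhds l, AEStronglyMeasurable (F l) μ) (hF2 : Integrable (F l) μ)
    (hF3 : AEStronglyMeasurable (F' l) μ)
    (hbd : ∀ᵐ θ ∂μ, ∀ l' ∈ Metric.closedBall l 1, ‖F' l' θ‖ ≤ C)
    (hci : Integrable (fun _ : α → ℝ => C) μ)
    (hdiff : ∀ᵐ θ ∂μ, ∀ l' ∈ Metric.closedBall l 1, HasFDerivAt (fun l => F l θ) (F' l' θ) l') :
    HasFDerivAt (fun l => ∫ θ, F l θ ∂μ) (∫ θ, F' l θ ∂μ) l :=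
  hasFDerivAt_integral_of_dominated_of_fderiv_le (Metric.closedBall_mem_nhds l one_pos)
    hF1 hF2 hF3 hbd hci hdiff

/-- derivative under the torus integral -/
theorem pd_integral {α : Type*} [Fintype α] [DecidableEq α] (P : (α → ℝ) → ℂ) (hP : Continuous P)
    (v : α → (α → ℝ) → ℂ) (hv : ∀ x, Continuous (v x)) (x : α) (l : α → ℝ) :
    pd x (fun l => ∫ θ in tbox α, P θ * Complex.exp (∑ y, (l y : ℂ) * v y θ)) l =
      ∫ θ in tbox α, v x θ * P θ * Complex.exp (∑ y, (l y : ℂ) * v y θ) := by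
  obtain ⟨F', hF'⟩ : ∃ F' : (α → ℝ) → (α → ℝ) → ((α → ℝ) →L[ℝ] ℂ), ∀ l θ, F' l θ =
    (P θ * Complex.exp (∑ y, (l y : ℂ) * v y θ)) • linForm (fun y => v y θ) := ⟨_, fun _ _ => rfl⟩
  have hF'c : Continuous (fun p : (α → ℝ) × (α → ℝ) => F' p.1 p.2) := by
    have h1 : ∀ x, Continuous (fun p : (α → ℝ) × (α → ℝ) => v x p.2) := fun x => (hv x).comp continuous_snd
    have h2 : Continuous (fun p : (α → ℝ) × (α → ℝ) => P p.2) := hP.comp continuous_snd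
    have h3 := linForm_cont (fun (p : (α → ℝ) × (α → ℝ)) x => v x p.2) h1
    simp only [hF']
    have h4 : Continuous (fun p : (α → ℝ) × (α → ℝ) =>
      P p.2 * Complex.exp (∑ y, (p.1 y : ℂ) * v y p.2)) := by fun_prop
    exact h4.smul h3
  obtain ⟨C, hC⟩ := ((isCompact_closedBall l 1).prod (tbox_compact α)).exists_bound_of_continuousOn
    hF'c.continuousOn
  have hF'l : Continuous (F' l) := hF'c.comp (Continuous.prodMk continuous_const continuous_id)
  have hFc : ∀ l : α → ℝ, Continuous (fun θ => P θ * Complex.exp (∑ y, (l y : ℂ) * v y θ)) := by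
    intro l; fun_prop
  have hmeas : MeasurableSet (tbox α) := (tbox_compact α).measurableSet
  have hF'int : IntegrableOn (F' l) (tbox α) :=
    hF'l.continuousOn.integrableOn_compact (tbox_compact α)
  have hdiff : ∀ θ l', HasFDerivAt (fun l : α → ℝ => P θ * Complex.exp (∑ y, (l y : ℂ) * v y θ))
      (F' l' θ) l' := by
    intro θ l'
    have h1 : HasFDerivAt (fun l : α → ℝ => ∑ y, (l y : ℂ) * v y θ)
        (linForm (fun y => v y θ)) l' := by
      simp only [← linForm_apply]
      exact (linForm (fun y => v y θ)).hasFDerivAt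
    have h2 := (h1.cexp).const_mul (P θ)
    rw [hF', mul_smul]
    exact h2
  have hbd : ∀ᵐ θ ∂(volume.restrict (tbox α)), ∀ l' ∈ Metric.closedBall l 1, ‖F' l' θ‖ ≤ C := by
    rw [ae_restrict_iff' hmeas]
    exact Filter.Eventually.of_forall fun θ hθ l' hl' => hC (l', θ) ⟨hl', hθ⟩
  have hci : Integrable (fun _ : α → ℝ => C) (volume.restrict (tbox α)) := by
    have := (tbox_compact α).measure_lt_top (μ := volume)
    exact integrableOn_const this.ne
  have hF1 : ∀ᶠ l in nhds l, AEStronglyMeasurable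
      (fun θ => P θ * Complex.exp (∑ y, (l y : ℂ) * v y θ)) (volume.restrict (tbox α)) :=
    Filter.Eventually.of_forall fun l => (hFc l).aestronglyMeasurable
  have hF2 : Integrable (fun θ => P θ * Complex.exp (∑ y, (l y : ℂ) * v y θ))
      (volume.restrict (tbox α)) := (hFc l).continuousOn.integrableOn_compact (tbox_compact α)
  have hF3 : AEStronglyMeasurable (F' l) (volume.restrict (tbox α)) := hF'l.aestronglyMeasurable
  have hdiff' : ∀ᵐ θ ∂(volume.restrict (tbox α)), ∀ l' ∈ Metric.closedBall l 1,
      HasFDerivAt (fun l : α → ℝ => P θ * Complex.exp (∑ y, (l y : ℂ) * v y θ)) (F' l' θ) l' :=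
    Filter.Eventually.of_forall fun θ l' _ => hdiff θ l'
  have key := param_deriv (fun l θ => P θ * Complex.exp (∑ y, ((l y : ℝ) : ℂ) * v y θ)) F' _ l C
    hF1 hF2 hF3 hbd hci hdiff'
  unfold pd
  rw [key.fderiv, ContinuousLinearMap.integral_apply hF'int]
  congr 1
  funext θ
  rw [hF']
  have : linForm (fun y => v y θ) (Pi.single x 1) = v x θ := by
    rw [linForm_apply, Finset.sum_eq_single x]
    · simp
    · intro y _ hy; simp [hy]
    · simp
  rw [smul_apply, this, smul_eq_mul]
  ring

/-- The vertex factor. -/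
def vf {α : Type*} [Fintype α] (A : Matrix α α ℝ) (u : α → ℂ) (x : α) : ℂ :=
  u x * ∑ y, (A x y : ℂ) * (u y)⁻¹

theorem vf_cont {α : Type*} [Fintype α] (A : Matrix α α ℝ) (x : α) :
    Continuous (fun θ : α → ℝ => vf A (eu θ) x) := by
  unfold vf
  have h : ∀ y, Continuous (fun θ : α → ℝ => eu θ y) := by intro y; unfold eu; fun_prop
  have h2 : ∀ y, Continuous (fun θ : α → ℝ => (eu θ y)⁻¹) := fun y => (h y).inv₀ (fun θ => Complex.exp_ne_zero _)
  fun_prop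

theorem vf_diff {α : Type*} [Fintype α] (A : Matrix α α ℝ) (x : α) (w : α → ℂ) (hw : ∀ x, w x ≠ 0) :
    DifferentiableAt ℂ (fun u => vf A u x) w := by
  unfold vf
  have h2 : ∀ y, DifferentiableAt ℂ (fun u : α → ℂ => (u y)⁻¹) w := fun y =>
    (differentiableAt_apply y w).inv (hw y)
  fun_prop

/-- energy -/
def energy {α : Type*} [Fintype α] (A : Matrix α α ℝ) (l : α → ℝ) (θ : α → ℝ) : ℂ :=
  ∑ x, ∑ y, (A x y : ℂ) * (Real.sqrt (l x * l y) : ℂ) *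
        Complex.exp (Complex.I * ((θ x : ℂ) - (θ y : ℂ)))

theorem vf_scaled {α : Type*} [Fintype α] (A : Matrix α α ℝ) (l : α → ℝ) (hl : ∀ x, 0 < l x) (θ : α → ℝ) :
    ∑ x, (l x : ℂ) * vf A (fun y => (((Real.sqrt (l y))⁻¹ : ℝ) : ℂ) * eu θ y) x = energy A l θ := by
  unfold energy vf
  refine Finset.sum_congr rfl fun x _ => ?_
  rw [Finset.mul_sum, Finset.mul_sum]
  refine Finset.sum_congr rfl fun y _ => ?_
  rw [Real.sqrt_mul (hl x).le]
  have h1 : (Real.sqrt (l x) : ℂ) ≠ 0 := by exact_mod_cast (Real.sqrt_pos.2 (hl x)).ne'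
  have h3 : (l x : ℂ) = (Real.sqrt (l x) : ℂ) * (Real.sqrt (l x) : ℂ) := by
    rw [← Complex.ofReal_mul, Real.mul_self_sqrt (hl x).le]
  rw [mul_sub, Complex.exp_sub, h3]
  unfold eu
  push_cast
  field_simp

theorem list_prod_cont {α : Type*} [Fintype α] (A : Matrix α α ℝ) (q : List α) :
    Continuous (fun θ : α → ℝ => (q.map (vf A (eu θ))).prod) := by
  induction q with
  | nil => simpa using continuous_const
  | cons x q ih =>
    simp only [List.map_cons, List.prod_cons]
    exact (vf_cont A x).mul ih

theorem list_prod_diff {α : Type*} [Fintype α] (A : Matrix α α ℝ) (q : List α) (w : α → ℂ) (hw : ∀ x, w x ≠ 0) :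
    DifferentiableAt ℂ (fun u : α → ℂ => (q.map (vf A u)).prod) w := by
  induction q with
  | nil => simp
  | cons x q ih =>
    simp only [List.map_cons, List.prod_cons]
    exact (vf_diff A x w hw).mul ih

theorem gauge_use {α : Type*} [Fintype α] [DecidableEq α] (A : Matrix α α ℝ) (q : List α) (l : α → ℝ) (hl : ∀ x, 0 < l x) :
    ∫ θ in tbox α, (q.map (vf A (eu θ))).prod * Complex.exp (∑ y, (l y : ℂ) * vf A (eu θ) y) =
    ∫ θ in tbox α, (q.map (vf A (fun y => (((Real.sqrt (l y))⁻¹ : ℝ) : ℂ) * eu θ y))).prod * Complex.exp (energy A l θ) := by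
  rw [torus_gauge (fun u => (q.map (vf A u)).prod * Complex.exp (∑ y, (l y : ℂ) * vf A u y)) _ (fun y => (Real.sqrt (l y))⁻¹) (fun y => inv_pos.2 (Real.sqrt_pos.2 (hl y)))]
  · simp only [vf_scaled A l hl]
  · intro w hw
    have h1 := list_prod_diff A q w hw
    have h2 := fun x => vf_diff A x w hw
    fun_prop

theorem foldr_pd_GM {α : Type*} [Fintype α] [DecidableEq α] (A : Matrix α α ℝ) (q : List α) (l : α → ℝ) (hl : ∀ x, 0 < l x) :
    q.foldr pd (GM A) l = ((2 * Real.pi : ℂ) ^ (Fintype.card α))⁻¹ *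
      ∫ θ in tbox α, (q.map (vf A (eu θ))).prod * Complex.exp (∑ y, (l y : ℂ) * vf A (eu θ) y) := by
  induction q generalizing l with
  | nil =>
    rw [gauge_use A [] l hl]
    simp [GM, energy, tbox]
  | cons x q ih =>
    have hopen : IsOpen {l : α → ℝ | ∀ x, 0 < l x} := by
      simp only [Set.ofPred_forall]
      exact isOpen_iInter_of_finite fun x => isOpen_lt continuous_const (continuous_apply x)
    have hev : (q.foldr pd (GM A)) =ᶠ[nhds l] (fun l =>
      ∫ θ in tbox α, (((2 * Real.pi : ℂ) ^ (Fintype.card α))⁻¹ * (q.map (vf A (eu θ))).prod) *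
        Complex.exp (∑ y, (l y : ℂ) * vf A (eu θ) y)) := by
      filter_upwards [hopen.mem_nhds hl] with l' hl'
      simp only [mul_assoc]
      rw [ih l' hl', integral_const_mul]
    have hpd := pd_integral (fun θ => ((2 * Real.pi : ℂ) ^ (Fintype.card α))⁻¹ * (q.map (vf A (eu θ))).prod)
      (continuous_const.mul (list_prod_cont A q)) (fun x θ => vf A (eu θ) x) (vf_cont A) x l
    simp only [List.foldr_cons, List.map_cons, List.prod_cons]
    unfold pd at hpd
    change fderiv ℝ (q.foldr pd (GM A)) l (Pi.single x 1) = _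
    rw [hev.fderiv_eq, hpd, ← integral_const_mul]
    congr 1
    funext θ
    ring

theorem rho_eq {α : Type*} [Fintype α] [DecidableEq α] (A : Matrix α α ℝ) (a b : α) (l : α → ℝ) (hl : ∀ x, 0 < l x) :
    rho A a b l = ((2 * Real.pi : ℂ) ^ (Fintype.card α))⁻¹ *
      ∫ θ in tbox α, (cofMat ((-A).map (fun r => (r : ℂ))) a b
        (vf A (fun y => (((Real.sqrt (l y))⁻¹ : ℝ) : ℂ) * eu θ y))).det * Complex.exp (energy A l θ) := by
  have hsc : Continuous (fun (θ : α → ℝ) => energy A l θ) := by unfold energy; fun_prop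
  have hvc : ∀ x, Continuous (fun θ : α → ℝ => vf A (fun y => (((Real.sqrt (l y))⁻¹ : ℝ) : ℂ) * eu θ y) x) := by
    intro x
    unfold vf
    have h : ∀ y, Continuous (fun θ : α → ℝ => (((Real.sqrt (l y))⁻¹ : ℝ) : ℂ) * eu θ y) := by
      intro y; unfold eu; fun_prop
    have h2 : ∀ y, Continuous (fun θ : α → ℝ => ((((Real.sqrt (l y))⁻¹ : ℝ) : ℂ) * eu θ y)⁻¹) := fun y =>
      (h y).inv₀ (fun θ => mul_ne_zero (by exact_mod_cast (inv_pos.2 (Real.sqrt_pos.2 (hl y))).ne') (Complex.exp_ne_zero _))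
    fun_prop
  unfold rho ddet mpart
  simp only [← cof_expand, Finset.sum_mul]
  rw [integral_finsetSum, Finset.mul_sum]
  · refine Finset.sum_congr rfl fun Q _ => ?_
    rw [foldr_pd_GM A _ l hl, gauge_use A _ l hl]
    simp only [Finset.prod_map_toList, mul_assoc]
    rw [integral_const_mul]
    ring
  · intro Q _
    apply ContinuousOn.integrableOn_compact (tbox_compact α)
    apply Continuous.continuousOn
    fun_prop

theorem energy_bound {α : Type*} [Fintype α] (A : Matrix α α ℝ)
    (hoff : ∀ x y, x ≠ y → 0 ≤ A x y) (l θ : α → ℝ) :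
    ‖Complex.exp (energy A l θ)‖ ≤ Real.exp (∑ x, ∑ y, A x y * Real.sqrt (l x * l y)) := by
  rw [Complex.norm_exp]
  apply Real.exp_le_exp.2
  unfold energy
  rw [Complex.re_sum]
  refine Finset.sum_le_sum fun x _ => ?_
  rw [Complex.re_sum]
  refine Finset.sum_le_sum fun y _ => ?_
  have h1 : ((A x y : ℂ) * (Real.sqrt (l x * l y) : ℂ) *
        Complex.exp (Complex.I * ((θ x : ℂ) - (θ y : ℂ)))).re =
        A x y * Real.sqrt (l x * l y) * Real.cos (θ x - θ y) := by
    rw [← Complex.ofReal_mul, Complex.re_ofReal_mul, ← Complex.ofReal_sub, mul_comm Complex.I,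
      Complex.exp_ofReal_mul_I_re]
  rw [h1]
  by_cases h : x = y
  · subst h; simp
  · exact mul_le_of_le_one_right (mul_nonneg (hoff x y h) (Real.sqrt_nonneg _)) (Real.cos_le_one _)

theorem eu_norm {α : Type*} (θ : α → ℝ) (x : α) : ‖eu θ x‖ = 1 := by
  unfold eu
  rw [mul_comm, Complex.norm_exp_ofReal_mul_I]

theorem vf_bound {α : Type*} [Fintype α] [DecidableEq α] (A : Matrix α α ℝ) (η T : ℝ)
    (hrow : ∀ x, ∑ y ∈ Finset.univ \ {x}, |A x y| ≤ η)
    (l : α → ℝ) (hl : ∀ x, 0 < l x) (hlT : ∀ x, l x ≤ T) (θ : α → ℝ) (x : α) :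
    ‖-(A x x : ℂ) + vf A (fun y => (((Real.sqrt (l y))⁻¹ : ℝ) : ℂ) * eu θ y) x‖ ≤
      η * Real.sqrt (T / l x) := by
  have hs : ∀ y, 0 < Real.sqrt (l y) := fun y => Real.sqrt_pos.2 (hl y)
  have hsc : ∀ y, (Real.sqrt (l y) : ℂ) ≠ 0 := fun y => by exact_mod_cast (hs y).ne'
  have he : ∀ y, eu θ y ≠ 0 := fun y => Complex.exp_ne_zero _
  have h1 : -(A x x : ℂ) + vf A (fun y => (((Real.sqrt (l y))⁻¹ : ℝ) : ℂ) * eu θ y) x =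
      ∑ y ∈ Finset.univ \ {x}, (A x y : ℂ) * ((Real.sqrt (l y) / Real.sqrt (l x) : ℝ) : ℂ) *
        (eu θ x * (eu θ y)⁻¹) := by
    unfold vf
    rw [Finset.mul_sum, ← Finset.sum_sdiff (Finset.subset_univ {x}), Finset.sum_singleton]
    have h2 := hsc x
    have h3 := he x
    have h4 : (((Real.sqrt (l x))⁻¹ : ℝ) : ℂ) * eu θ x *
      ((A x x : ℂ) * ((((Real.sqrt (l x))⁻¹ : ℝ) : ℂ) * eu θ x)⁻¹) = A x x := by
      push_cast
      field_simp
    rw [h4, add_comm, add_neg_cancel_right]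
    refine Finset.sum_congr rfl fun y _ => ?_
    have h5 := hsc y
    have h6 := he y
    push_cast
    field_simp
  rw [h1]
  calc _ ≤ ∑ y ∈ Finset.univ \ {x}, |A x y| * Real.sqrt (T / l x) := by
        refine (norm_sum_le _ _).trans (Finset.sum_le_sum fun y _ => ?_)
        rw [norm_mul, norm_mul, norm_mul, norm_inv, eu_norm, eu_norm, Complex.norm_real,
          Complex.norm_real, Real.norm_eq_abs, Real.norm_eq_abs, inv_one, mul_one, mul_one]
        refine mul_le_mul_of_nonneg_left ?_ (abs_nonneg _)
        rw [abs_of_pos (div_pos (hs y) (hs x)), Real.sqrt_div ((hl x).le.trans (hlT x))]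
        exact div_le_div_of_nonneg_right (Real.sqrt_le_sqrt (hlT y)) (hs x).le
    _ ≤ _ := by
        rw [← Finset.sum_mul]
        exact mul_le_mul_of_nonneg_right (hrow x) (Real.sqrt_nonneg _)

theorem cofMat_bound {α : Type*} [Fintype α] [DecidableEq α] (A : Matrix α α ℝ) (η T : ℝ)
    (hη : 1 ≤ η) (hrow : ∀ x, ∑ y ∈ Finset.univ \ {x}, |A x y| ≤ η) (a b : α)
    (l : α → ℝ) (hl : ∀ x, 0 < l x) (hlT : ∀ x, l x ≤ T) (θ : α → ℝ) :
    ‖(cofMat ((-A).map (fun r => (r : ℂ))) a b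
        (vf A (fun y => (((Real.sqrt (l y))⁻¹ : ℝ) : ℂ) * eu θ y))).det‖ ≤
      ∏ x, (η * (if x = a then 1 else 1 + Real.sqrt (T / l x))) := by
  have hη0 : 0 ≤ η := by linarith
  refine (det_row_bound _).trans (Finset.prod_le_prod
    (fun x _ => Finset.sum_nonneg fun y _ => norm_nonneg _) fun x _ => ?_)
  have hone : 1 ≤ (if x = a then 1 else 1 + Real.sqrt (T / l x)) := by
    split_ifs
    · exact le_rfl
    · linarith [Real.sqrt_nonneg (T / l x)]
  by_cases hxb : x = b
  · subst hxb
    have : ∀ y, ‖cofMat ((-A).map (fun r => (r : ℂ))) a x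
        (vf A (fun y => (((Real.sqrt (l y))⁻¹ : ℝ) : ℂ) * eu θ y)) x y‖ = if y = a then 1 else 0 := by
      intro y
      by_cases h : x = y <;> by_cases h' : y = a <;> simp [cofMat, h, h', Matrix.diagonal]
    simp only [this]
    simp only [Finset.sum_ite_eq', Finset.mem_univ, if_true]
    nlinarith
  · rw [← Finset.sum_sdiff (Finset.subset_univ {x}), Finset.sum_singleton]
    have h1 : ∑ y ∈ Finset.univ \ {x}, ‖cofMat ((-A).map (fun r => (r : ℂ))) a b
        (vf A (fun y => (((Real.sqrt (l y))⁻¹ : ℝ) : ℂ) * eu θ y)) x y‖ ≤ η := by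
      refine le_trans (Finset.sum_le_sum fun y hy => ?_) (hrow x)
      have hxy : x ≠ y := by
        rintro rfl; simp at hy
      by_cases h' : y = a
      · subst h'; simp [cofMat, hxb, hxy]
      · simp [cofMat, hxb, h', hxy]
    have h2 : ‖cofMat ((-A).map (fun r => (r : ℂ))) a b
        (vf A (fun y => (((Real.sqrt (l y))⁻¹ : ℝ) : ℂ) * eu θ y)) x x‖ ≤
        if x = a then 0 else η * Real.sqrt (T / l x) := by
      by_cases h : x = a
      · subst h; simp [cofMat, hxb]
      · have := vf_bound A η T hrow l hl hlT θ x
        simpa [cofMat, hxb, h] using this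
    refine (add_le_add h1 h2).trans (le_of_eq ?_)
    split_ifs <;> ring

theorem rho_bound {α : Type*} [Fintype α] [DecidableEq α] (A : Matrix α α ℝ) (η T : ℝ)
    (hη : 1 ≤ η) (hoff : ∀ x y, x ≠ y → 0 ≤ A x y)
    (hrow : ∀ x, ∑ y ∈ Finset.univ \ {x}, |A x y| ≤ η) (a b : α)
    (l : α → ℝ) (hl : ∀ x, 0 < l x) (hlT : ∀ x, l x ≤ T) :
    ‖rho A a b l‖ ≤ (∏ x, (η * (if x = a then 1 else 1 + Real.sqrt (T / l x)))) *
      Real.exp (∑ x, ∑ y, A x y * Real.sqrt (l x * l y)) := by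
  rw [rho_eq A a b l hl, norm_mul]
  have hvol : (volume : Measure (α → ℝ)).real (tbox α) = (2 * Real.pi) ^ Fintype.card α := by
    unfold tbox Measure.real
    rw [volume_pi_pi]
    simp [Real.pi_pos.le]
  have hlt : (volume : Measure (α → ℝ)) (tbox α) < ⊤ := (tbox_compact α).measure_lt_top
  have h := norm_setIntegral_le_of_norm_le_const (μ := (volume : Measure (α → ℝ))) (s := tbox α)
    (f := fun θ => (cofMat ((-A).map (fun r => (r : ℂ))) a b
        (vf A (fun y => (((Real.sqrt (l y))⁻¹ : ℝ) : ℂ) * eu θ y))).det * Complex.exp (energy A l θ))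
    (C := (∏ x, (η * (if x = a then 1 else 1 + Real.sqrt (T / l x)))) *
      Real.exp (∑ x, ∑ y, A x y * Real.sqrt (l x * l y))) hlt
    (fun θ _ => by
      have h0 := cofMat_bound A η T hη hrow a b l hl hlT θ
      rw [norm_mul]
      exact mul_le_mul h0 (energy_bound A hoff l θ) (norm_nonneg _) ((norm_nonneg _).trans h0))
  rw [hvol] at h
  have hp : (0:ℝ) < (2 * Real.pi) ^ Fintype.card α := by positivity
  have hn : ‖((2 * Real.pi : ℂ) ^ (Fintype.card α))⁻¹‖ = ((2 * Real.pi) ^ Fintype.card α)⁻¹ := by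
    rw [norm_inv, norm_pow, norm_mul, Complex.norm_real, Real.norm_of_nonneg Real.pi_pos.le]
    simp
  rw [hn, inv_mul_le_iff₀ hp, mul_comm]
  exact h.trans_eq (mul_comm _ _) |>.trans_eq (mul_comm _ _)

theorem one_dim_int (T : ℝ) (hT : 0 < T) :
    IntegrableOn (fun t : ℝ => 1 + Real.sqrt (T / t)) (Set.Ioc 0 T) ∧
    ∫ t in Set.Ioc 0 T, (1 + Real.sqrt (T / t)) = 3 * T := by
  have h0 : ∀ t ∈ Set.Ioc 0 T, 1 + Real.sqrt (T / t) = 1 + Real.sqrt T * t ^ (-(1/2) : ℝ) := by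
    intro t ht
    rw [Real.sqrt_div hT.le, Real.rpow_neg ht.1.le, ← Real.sqrt_eq_rpow, div_eq_mul_inv]
  have hi : IntervalIntegrable (fun t : ℝ => t ^ (-(1/2) : ℝ)) volume 0 T :=
    intervalIntegral.intervalIntegrable_rpow' (by norm_num)
  have hi2 : IntervalIntegrable (fun t : ℝ => 1 + Real.sqrt T * t ^ (-(1/2) : ℝ)) volume 0 T :=
    intervalIntegrable_const.add (hi.const_mul _)
  constructor
  · rw [integrableOn_congr_fun h0 measurableSet_Ioc]
    exact (intervalIntegrable_iff_integrableOn_Ioc_of_le hT.le).1 hi2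
  · rw [setIntegral_congr_fun measurableSet_Ioc h0, ← intervalIntegral.integral_of_le hT.le,
      intervalIntegral.integral_add intervalIntegrable_const (hi.const_mul _),
      intervalIntegral.integral_const_mul, integral_rpow (Or.inl (by norm_num))]
    have h1 : (-(1/2) + 1 : ℝ) = 1/2 := by norm_num
    rw [h1, Real.zero_rpow (by norm_num), ← Real.sqrt_eq_rpow]
    have h2 := Real.mul_self_sqrt hT.le
    simp only [intervalIntegral.integral_const, smul_eq_mul]
    field_simp
    nlinarith

theorem simplex_int {β : Type*} [Fintype β] (T : ℝ) (hT : 0 < T) :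
    ∫⁻ t in {t : β → ℝ | (∀ x, 0 < t x) ∧ ∑ x, t x < T},
      ENNReal.ofReal (∏ x, (1 + Real.sqrt (T / t x))) ≤ ENNReal.ofReal ((3 * T) ^ Fintype.card β) := by
  have hsub : {t : β → ℝ | (∀ x, 0 < t x) ∧ ∑ x, t x < T} ⊆ Set.univ.pi fun _ => Set.Ioc 0 T := by
    rintro t ⟨h1, h2⟩ x _
    exact ⟨h1 x, (Finset.single_le_sum (fun y _ => (h1 y).le) (Finset.mem_univ x)).trans h2.le⟩
  refine (lintegral_mono_set hsub).trans ?_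
  obtain ⟨hi, hv⟩ := one_dim_int T hT
  rw [volume_pi, Measure.restrict_pi_pi, ← ofReal_integral_eq_lintegral_ofReal]
  · rw [integral_fintype_prod_eq_prod (fun _ : β => fun t : ℝ => 1 + Real.sqrt (T / t))]
    rw [hv]
    simp
  · exact Integrable.fintype_prod (f := fun _ : β => fun t : ℝ => 1 + Real.sqrt (T / t)) (fun _ => hi)
  · exact Filter.Eventually.of_forall fun t => Finset.prod_nonneg fun x _ => by positivity

theorem sum_ext_zero {S : Type*} [Fintype S] [DecidableEq S] (R : Finset S) (g : S → ℝ)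
    (hg : ∀ x, x ∉ R → g x = 0) : ∑ x, g x = ∑ x : R, g x := by
  rw [Finset.sum_coe_sort R g]
  exact (Finset.sum_subset (Finset.subset_univ R) (fun x _ hx => hg x hx)).symm

theorem term_bound {S : Type*} [Fintype S] [DecidableEq S]
    (A : Matrix S S ℝ) (hA_offdiag : ∀ x y, x ≠ y → 0 ≤ A x y)
    (T : ℝ) (hT : 1 ≤ T) (η : ℝ) (hη : 1 ≤ η)
    (hrow : ∀ x, ∑ y ∈ Finset.univ \ {x}, |A x y| ≤ η)
    (F : (S → ℝ) → ℝ) (R : Finset S) (a b : R) :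
    sigmaLInt a T (fun l : R → ℝ =>
            ENNReal.ofReal
              (Real.exp (T * F (fun x : S => if hx : x ∈ R then l ⟨x, hx⟩ / T else 0)) *
                (rho (Matrix.of fun x y : R => A x y) a b l).re)) ≤
      ENNReal.ofReal (η ^ Fintype.card S * (3 * T) ^ R.card) *
      ⨆ μ ∈ {μ : S → ℝ | (∀ x, 0 ≤ μ x ∧ μ x ≤ 1) ∧ ∑ x, μ x = 1},
            ENNReal.ofReal
              (Real.exp (T * (F μ - ∑ x, ∑ y,
                Real.sqrt (μ x) * (-(A x y)) * Real.sqrt (μ y)))) := by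
  have hT0 : 0 < T := by linarith
  have hη0 : 0 ≤ η := by linarith
  set M := ⨆ μ ∈ {μ : S → ℝ | (∀ x, 0 ≤ μ x ∧ μ x ≤ 1) ∧ ∑ x, μ x = 1},
            ENNReal.ofReal
              (Real.exp (T * (F μ - ∑ x, ∑ y,
                Real.sqrt (μ x) * (-(A x y)) * Real.sqrt (μ y)))) with hM
  have hrowR : ∀ x : R, ∑ y ∈ Finset.univ \ {x}, |(Matrix.of fun x y : R => A x y) x y| ≤ η := by
    intro x
    refine le_trans ?_ (hrow x)
    have := Finset.sum_map (Finset.univ \ {x}) (Function.Embedding.subtype (· ∈ R)) (fun y => |A x y|)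
    simp only [Function.Embedding.subtype_apply] at this
    simp only [Matrix.of_apply]
    rw [← this]
    refine Finset.sum_le_sum_of_subset_of_nonneg ?_ (fun _ _ _ => abs_nonneg _)
    intro y hy
    simp only [Finset.mem_map, Finset.mem_sdiff, Finset.mem_singleton, Finset.mem_univ, true_and] at hy ⊢
    obtain ⟨z, hz, rfl⟩ := hy
    exact fun h => hz (Subtype.ext h)
  have hpt : ∀ l : R → ℝ, (∀ x, 0 < l x) → ∑ x, l x = T →
      ENNReal.ofReal
              (Real.exp (T * F (fun x : S => if hx : x ∈ R then l ⟨x, hx⟩ / T else 0)) *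
                (rho (Matrix.of fun x y : R => A x y) a b l).re) ≤
      ENNReal.ofReal (∏ x, (η * (if x = a then 1 else 1 + Real.sqrt (T / l x)))) * M := by
    intro l hl hsum
    have hlT : ∀ x, l x ≤ T := fun x =>
      (Finset.single_le_sum (fun y _ => (hl y).le) (Finset.mem_univ x)).trans hsum.le
    set μ : S → ℝ := fun x : S => if hx : x ∈ R then l ⟨x, hx⟩ / T else 0 with hμ
    have hμR : ∀ x : R, μ x = l x / T := fun x => by simp [hμ]
    have hμ0 : ∀ x, x ∉ R → μ x = 0 := fun x hx => by simp [hμ, hx]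
    have hmem : μ ∈ {μ : S → ℝ | (∀ x, 0 ≤ μ x ∧ μ x ≤ 1) ∧ ∑ x, μ x = 1} := by
      refine ⟨fun x => ?_, ?_⟩
      · by_cases hx : x ∈ R
        · rw [hμR ⟨x, hx⟩]
          exact ⟨(div_pos (hl _) hT0).le, (div_le_one hT0).2 (hlT _)⟩
        · rw [hμ0 x hx]; norm_num
      · rw [sum_ext_zero R μ hμ0]
        simp only [hμR]
        rw [← Finset.sum_div, hsum, div_self hT0.ne']
    have hen : ∑ x : R, ∑ y : R, (Matrix.of fun x y : R => A x y) x y * Real.sqrt (l x * l y) =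
        - (T * ∑ x, ∑ y, Real.sqrt (μ x) * (-(A x y)) * Real.sqrt (μ y)) := by
      rw [sum_ext_zero R (fun x => ∑ y, Real.sqrt (μ x) * (-(A x y)) * Real.sqrt (μ y))
        (fun x hx => by simp [hμ0 x hx]), Finset.mul_sum, ← Finset.sum_neg_distrib]
      refine Finset.sum_congr rfl fun x _ => ?_
      rw [sum_ext_zero R (fun y => Real.sqrt (μ x) * (-(A x y)) * Real.sqrt (μ y))
        (fun y hy => by simp [hμ0 y hy]), Finset.mul_sum, ← Finset.sum_neg_distrib]
      refine Finset.sum_congr rfl fun y _ => ?_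
      rw [hμR, hμR, Real.sqrt_mul (hl x).le, Real.sqrt_div (hl x).le, Real.sqrt_div (hl y).le]
      have hs : Real.sqrt T ≠ 0 := (Real.sqrt_pos.2 hT0).ne'
      have hs2 := Real.mul_self_sqrt hT0.le
      simp only [Matrix.of_apply]
      field_simp
      rw [Real.sq_sqrt hT0.le]
    have hb := rho_bound (Matrix.of fun x y : R => A x y) η T hη
      (fun x y hxy => hA_offdiag x y (fun h => hxy (Subtype.ext h))) hrowR a b l hl hlT
    rw [hen] at hb
    have hP0 : 0 ≤ ∏ x, (η * (if x = a then 1 else 1 + Real.sqrt (T / l x))) :=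
      Finset.prod_nonneg fun x _ => mul_nonneg hη0 (by split_ifs <;> positivity)
    have hre := (Complex.re_le_norm _).trans hb
    have h1 : Real.exp (T * F μ) * (rho (Matrix.of fun x y : R => A x y) a b l).re ≤
        (∏ x, (η * (if x = a then 1 else 1 + Real.sqrt (T / l x)))) *
        Real.exp (T * (F μ - ∑ x, ∑ y, Real.sqrt (μ x) * (-(A x y)) * Real.sqrt (μ y))) := by
      refine (mul_le_mul_of_nonneg_left hre (Real.exp_pos _).le).trans_eq ?_
      rw [mul_sub, sub_eq_add_neg, Real.exp_add]
      ring
    refine (ENNReal.ofReal_le_ofReal h1).trans ?_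
    rw [ENNReal.ofReal_mul hP0]
    refine mul_le_mul' le_rfl ?_
    rw [hM]
    exact le_iSup₂ (f := fun (μ : S → ℝ)
      (_ : μ ∈ {μ : S → ℝ | (∀ x, 0 ≤ μ x ∧ μ x ≤ 1) ∧ ∑ x, μ x = 1}) =>
        ENNReal.ofReal (Real.exp (T * (F μ - ∑ x, ∑ y,
          Real.sqrt (μ x) * (-(A x y)) * Real.sqrt (μ y))))) μ hmem
  have hset : MeasurableSet {t : {x : R // x ≠ a} → ℝ | (∀ x, 0 < t x) ∧ ∑ x, t x < T} := by
    have h1 : IsOpen {t : {x : R // x ≠ a} → ℝ | ∀ x, 0 < t x} := by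
      simp only [Set.ofPred_forall]
      exact isOpen_iInter_of_finite fun x => isOpen_lt continuous_const (continuous_apply x)
    have h2 : IsOpen {t : {x : R // x ≠ a} → ℝ | ∑ x, t x < T} :=
      isOpen_lt (by fun_prop) continuous_const
    exact (h1.inter h2).measurableSet
  unfold sigmaLInt
  have hprod : ∀ t : {x : R // x ≠ a} → ℝ,
      ∏ x, (η * (if x = a then 1 else 1 + Real.sqrt (T /
        (if hx : x = a then T - ∑ y, t y else t ⟨x, hx⟩)))) =
      η ^ R.card * ∏ x, (1 + Real.sqrt (T / t x)) := by
    intro t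
    rw [Finset.prod_mul_distrib, Finset.prod_const, Finset.card_univ, Fintype.card_coe]
    congr 1
    rw [← Fintype.prod_subtype_mul_prod_subtype (fun x => x = a)]
    refine (congrArg₂ (· * ·) (Finset.prod_eq_one fun x _ => by simp [x.2])
      (Finset.prod_congr rfl fun x _ => ?_)).trans (one_mul _)
    have := x.2
    simp [this]
  calc _ ≤ ∫⁻ t in {t : {x : R // x ≠ a} → ℝ | (∀ x, 0 < t x) ∧ ∑ x, t x < T},
        (ENNReal.ofReal (∏ x, (1 + Real.sqrt (T / t x)))) * (ENNReal.ofReal (η ^ R.card) * M) := by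
        refine setLIntegral_mono' hset fun t ht => ?_
        refine (hpt (fun x => if hx : x = a then T - ∑ y, t y else t ⟨x, hx⟩) ?_ ?_).trans_eq ?_
        · intro x
          by_cases hx : x = a
          · simp only [hx, dif_pos]; linarith [ht.2]
          · simp only [hx, dif_neg, not_false_eq_true]; exact ht.1 _
        · rw [Fintype.sum_eq_add_sum_subtype_ne _ a]
          have h2 : ∀ x : {x : R // x ≠ a},
              (if hx : (x : R) = a then T - ∑ y, t y else t ⟨x, hx⟩) = t x := fun x => by
            have := x.2
            simp [this]
          simp only [h2, dif_pos]
          ring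
        · rw [hprod, ENNReal.ofReal_mul (by positivity)]
          ring
    _ = (∫⁻ t in {t : {x : R // x ≠ a} → ℝ | (∀ x, 0 < t x) ∧ ∑ x, t x < T},
        (ENNReal.ofReal (∏ x, (1 + Real.sqrt (T / t x))))) * (ENNReal.ofReal (η ^ R.card) * M) := by
        refine lintegral_mul_const _ ?_
        fun_prop
    _ ≤ ENNReal.ofReal ((3 * T) ^ R.card) * (ENNReal.ofReal (η ^ Fintype.card S) * M) := by
        refine mul_le_mul' ((simplex_int T hT0).trans (ENNReal.ofReal_le_ofReal ?_)) 
          (mul_le_mul' (ENNReal.ofReal_le_ofReal ?_) le_rfl)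
        · refine pow_le_pow_right₀ (by linarith) ?_
          exact (Fintype.card_subtype_le _).trans_eq (Fintype.card_coe R)
        · exact pow_le_pow_right₀ hη (Finset.card_le_univ R)
    _ = _ := by
        rw [← mul_assoc, ← ENNReal.ofReal_mul (by positivity), mul_comm ((3 * T) ^ R.card)]

/-- **Theorem 3.6(ii): upper bound in Varadhan's lemma for arbitrary measurable
functionals.** Let `A` be a symmetric sub-generator on `S`, `η_S` as in (3.2),
`a ∈ S`, `T ≥ 1`, and `F : M_1(S) → ℝ` Borel measurable. Then, in `[0,∞]`,
`Σ_{b∈S} Σ_{R : {a,b} ⊆ R ⊆ S} ∫_{M_T^+(R)} e^{T F(ext_S(l/T))} ρ_{ab}^{(R)}(l) σ_T(dl)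
 ≤ |S| (η_S √(8e) T)^{|S|} e^{|S|/(4T)}
   exp(T sup_{μ∈M_1(S)} [F(μ) − Σ √μ_x(−A_{x,y})√μ_y])`. -/
theorem varadhan_upper_bound_measurable_functional
    {S : Type*} [Fintype S] [DecidableEq S] [Nonempty S]
    (A : Matrix S S ℝ)
    (hA_symm : ∀ x y, A x y = A y x)
    (hA_offdiag : ∀ x y, x ≠ y → 0 ≤ A x y)
    (hA_rowsum : ∀ x, ∑ y, A x y ≤ 0)
    (a : S) (T : ℝ) (hT : 1 ≤ T)
    (η : ℝ)
    (hη : η = max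
      (Finset.univ.sup' ⟨a, Finset.mem_univ a⟩
        (fun x => ∑ y ∈ Finset.univ \ {x}, |A x y|)) 1)
    (F : (S → ℝ) → ℝ) (hF_meas : Measurable F) :
    (∑ b : S, ∑ R : Finset S,
        (if h : a ∈ R ∧ b ∈ R then
          sigmaLInt (⟨a, h.1⟩ : R) T (fun l : R → ℝ =>
            ENNReal.ofReal
              (Real.exp (T * F (fun x : S => if hx : x ∈ R then l ⟨x, hx⟩ / T else 0)) *
                (rho (Matrix.of fun x y : R => A x y) ⟨a, h.1⟩ ⟨b, h.2⟩ l).re))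
        else 0))
      ≤ ENNReal.ofReal ((Fintype.card S : ℝ) *
            (η * Real.sqrt (8 * Real.exp 1) * T) ^ (Fintype.card S) *
            Real.exp ((Fintype.card S : ℝ) / (4 * T))) *
          ⨆ μ ∈ {μ : S → ℝ | (∀ x, 0 ≤ μ x ∧ μ x ≤ 1) ∧ ∑ x, μ x = 1},
            ENNReal.ofReal
              (Real.exp (T * (F μ - ∑ x, ∑ y,
                Real.sqrt (μ x) * (-(A x y)) * Real.sqrt (μ y)))) := by
  have hη1 : 1 ≤ η := by rw [hη]; exact le_max_right _ _
  have hrow : ∀ x, ∑ y ∈ Finset.univ \ {x}, |A x y| ≤ η := by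
    intro x
    rw [hη]
    exact le_max_of_le_left (Finset.le_sup' (fun x => ∑ y ∈ Finset.univ \ {x}, |A x y|)
      (Finset.mem_univ x))
  have hT0 : 0 < T := by linarith
  set M := ⨆ μ ∈ {μ : S → ℝ | (∀ x, 0 ≤ μ x ∧ μ x ≤ 1) ∧ ∑ x, μ x = 1},
            ENNReal.ofReal
              (Real.exp (T * (F μ - ∑ x, ∑ y,
                Real.sqrt (μ x) * (-(A x y)) * Real.sqrt (μ y)))) with hM
  have hterm : ∀ b : S, ∀ R : Finset S,
      (if h : a ∈ R ∧ b ∈ R then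
          sigmaLInt (⟨a, h.1⟩ : R) T (fun l : R → ℝ =>
            ENNReal.ofReal
              (Real.exp (T * F (fun x : S => if hx : x ∈ R then l ⟨x, hx⟩ / T else 0)) *
                (rho (Matrix.of fun x y : R => A x y) ⟨a, h.1⟩ ⟨b, h.2⟩ l).re))
        else 0) ≤ ENNReal.ofReal (η ^ Fintype.card S * (3 * T) ^ R.card) * M := by
    intro b R
    split_ifs with h
    · exact term_bound A hA_offdiag T hT η hη1 hrow F R ⟨a, h.1⟩ ⟨b, h.2⟩
    · exact zero_le
  refine (Finset.sum_le_sum fun b _ => Finset.sum_le_sum fun R _ => hterm b R).trans ?_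
  have hsum : ∑ R : Finset S, ENNReal.ofReal (η ^ Fintype.card S * (3 * T) ^ R.card) * M =
      ENNReal.ofReal (η ^ Fintype.card S * (3 * T + 1) ^ Fintype.card S) * M := by
    rw [← Finset.sum_mul, ← ENNReal.ofReal_sum_of_nonneg (fun _ _ => by positivity),
      ← Finset.mul_sum]
    have := Fintype.sum_pow_mul_eq_add_pow S (3 * T) (1 : ℝ)
    simp only [one_pow, mul_one] at this
    rw [this]
  rw [hsum, Finset.sum_const, Finset.card_univ, nsmul_eq_mul, ← mul_assoc,
    ← ENNReal.ofReal_natCast, ← ENNReal.ofReal_mul (by positivity)]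
  refine mul_le_mul' (ENNReal.ofReal_le_ofReal ?_) le_rfl
  have h4 : 4 ≤ Real.sqrt (8 * Real.exp 1) := by
    apply Real.le_sqrt_of_sq_le
    nlinarith [Real.add_one_le_exp 1]
  have hbase : 3 * T + 1 ≤ Real.sqrt (8 * Real.exp 1) * T := by nlinarith
  have hexp : 1 ≤ Real.exp ((Fintype.card S : ℝ) / (4 * T)) := Real.one_le_exp (by positivity)
  rw [← mul_pow]
  have hp : (η * (3 * T + 1)) ^ Fintype.card S ≤
      (η * Real.sqrt (8 * Real.exp 1) * T) ^ Fintype.card S := by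
    refine pow_le_pow_left₀ (by positivity) ?_ _
    rw [mul_assoc]
    exact mul_le_mul_of_nonneg_left hbase (by linarith)
  refine (mul_le_mul_of_nonneg_left hp (by positivity)).trans ?_
  exact le_mul_of_one_le_right (by positivity) hexp


end
end

section
/- Let R be a finite set, let B be any real R×R matrix, and let l, r ∈ (0,∞)^R. Then ∫_{[0,2π]^R} exp(Σ_{x,y∈R} B_{x,y} √(l_x l_y) e^{i(θ_x−θ_y)}) ∏_{x∈R} dθ_x/(2π) = ∫_{[0,2π]^R} exp(Σ_{x,y∈R} r_x B_{x,y} r_y^{-1} √(l_x l_y) e^{i(θ_x−θ_y)}) ∏_{x∈R} dθ_x/(2π); that is, G_B(l) = G_{B^{(r)}}(l), where B^{(r)}_{x,y} = r_x B_{x,y} r_y^{-1}. -/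
open MeasureTheory Finset

noncomputable section

/-- Shift of contour for an entire `2π`-periodic function. -/
lemma contour_shift (g : ℂ → ℂ) (hg : Differentiable ℂ g)
    (hp : ∀ z, g (z + (2 * Real.pi : ℝ)) = g z) (a c : ℝ) :
    ∫ t in Set.Icc (0:ℝ) (2 * Real.pi), g (t + a * Complex.I) =
      ∫ t in Set.Icc (0:ℝ) (2 * Real.pi), g (t + c * Complex.I) := by
  have h2 : (0:ℝ) ≤ 2 * Real.pi := by positivity
  rw [integral_Icc_eq_integral_Ioc, integral_Icc_eq_integral_Ioc,
    ← intervalIntegral.integral_of_le h2, ← intervalIntegral.integral_of_le h2]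
  have h := Complex.integral_boundary_rect_eq_zero_of_differentiableOn g
    ⟨0, a⟩ ⟨2 * Real.pi, c⟩ hg.differentiableOn
  have e : ∀ y : ℝ, g (((2 * Real.pi : ℝ) : ℂ) + y * Complex.I) =
      g (((0:ℝ) : ℂ) + y * Complex.I) := by
    intro y
    rw [← hp (((0:ℝ) : ℂ) + y * Complex.I)]
    congr 1
    push_cast
    ring
  simp only [e] at h
  rw [add_sub_cancel_right] at h
  exact sub_eq_zero.mp h

/-- Resampling one coordinate. -/
lemma pi_resample {R : Type*} [Fintype R] [DecidableEq R] (μ : Measure ℝ) [IsFiniteMeasure μ]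
    (hμ : μ Set.univ ≠ 0) (x : R) :
    Measure.pi (fun _ : R => μ) = (μ Set.univ)⁻¹ •
      ((Measure.pi (fun _ : R => μ)).prod μ).map
        (fun p : (R → ℝ) × ℝ => Function.update p.1 x p.2) := by
  have hm : Measurable (fun p : (R → ℝ) × ℝ => Function.update p.1 x p.2) := by
    fun_prop
  refine (Measure.pi_eq fun s hs => ?_)
  rw [Measure.smul_apply, Measure.map_apply hm (MeasurableSet.univ_pi hs)]
  have : (fun p : (R → ℝ) × ℝ => Function.update p.1 x p.2) ⁻¹' (Set.univ.pi s) =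
      (Set.univ.pi (Function.update s x Set.univ)) ×ˢ s x := by
    ext p
    simp only [Set.mem_preimage, Set.mem_pi, Set.mem_univ, true_implies, Set.mem_prod]
    constructor
    · intro h
      refine ⟨fun i => ?_, by simpa using h x⟩
      by_cases hi : i = x
      · subst hi; simp
      · simpa [hi] using h i
    · rintro ⟨h, h'⟩ i
      by_cases hi : i = x
      · subst hi; simpa using h'
      · simpa [hi] using h i
  rw [this, Measure.prod_prod, Measure.pi_pi,
    ← Finset.mul_prod_erase Finset.univ _ (Finset.mem_univ x),
    ← Finset.mul_prod_erase Finset.univ (fun i => μ (s i)) (Finset.mem_univ x)]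
  have e : ∏ i ∈ Finset.univ.erase x, μ (Function.update s x Set.univ i) =
      ∏ i ∈ Finset.univ.erase x, μ (s i) := by
    refine Finset.prod_congr rfl fun i hi => ?_
    rw [Function.update_of_ne (Finset.ne_of_mem_erase hi)]
  rw [e, Function.update_self, smul_eq_mul, mul_assoc, ← mul_assoc,
    ENNReal.inv_mul_cancel hμ (measure_ne_top _ _), one_mul, mul_comm]

/-- Two integrals agree when all one-coordinate integrals agree. -/
lemma integral_pi_congr_coord {R : Type*} [Fintype R] [DecidableEq R] (f g : (R → ℝ) → ℂ)
    (hf : Continuous f) (hg : Continuous g) (x : R)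
    (h : ∀ θ : R → ℝ, ∫ t in Set.Icc (0:ℝ) (2 * Real.pi), f (Function.update θ x t) =
      ∫ t in Set.Icc (0:ℝ) (2 * Real.pi), g (Function.update θ x t)) :
    ∫ θ in Set.univ.pi (fun _ : R => Set.Icc (0:ℝ) (2 * Real.pi)), f θ =
      ∫ θ in Set.univ.pi (fun _ : R => Set.Icc (0:ℝ) (2 * Real.pi)), g θ := by
  set μ : Measure ℝ := volume.restrict (Set.Icc (0:ℝ) (2 * Real.pi)) with hμd
  have hμ : μ Set.univ ≠ 0 := by
    simp [hμd, Real.pi_pos]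
  have hv : (volume : Measure (R → ℝ)).restrict
      (Set.univ.pi (fun _ : R => Set.Icc (0:ℝ) (2 * Real.pi))) =
      Measure.pi (fun _ : R => μ) := by
    rw [volume_pi, Measure.restrict_pi_pi]
  have hm : Continuous (fun p : (R → ℝ) × ℝ => Function.update p.1 x p.2) := by
    fun_prop
  have key : ∀ f : (R → ℝ) → ℂ, Continuous f →
      ∫ θ in Set.univ.pi (fun _ : R => Set.Icc (0:ℝ) (2 * Real.pi)), f θ =
      ((μ Set.univ)⁻¹).toReal • ∫ θ, ∫ t, f (Function.update θ x t) ∂μ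
        ∂(Measure.pi (fun _ : R => μ)) := by
    intro f hf
    rw [hv]
    conv_lhs => rw [pi_resample μ hμ x]
    rw [integral_smul_measure, integral_map hm.aemeasurable hf.aestronglyMeasurable,
      integral_prod]
    rw [← hv, hμd, Measure.prod_restrict]
    have hK : IsCompact ((Set.univ.pi (fun _ : R => Set.Icc (0:ℝ) (2 * Real.pi))) ×ˢ
      Set.Icc (0:ℝ) (2 * Real.pi)) :=
      (isCompact_univ_pi fun _ => isCompact_Icc).prod isCompact_Icc
    exact (hf.comp hm).continuousOn.integrableOn_compact hK
  rw [key f hf, key g hg]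
  simp only [h]

/-- The integrand as a function of complex angles. -/
def FF {R : Type*} [Fintype R] (B : Matrix R R ℝ) (l : R → ℝ) (w : R → ℂ) : ℂ :=
  Complex.exp (∑ x, ∑ y, (B x y : ℂ) * (Real.sqrt (l x * l y) : ℂ) *
        Complex.exp (Complex.I * (w x - w y)))

lemma FF_diff {R : Type*} [Fintype R] (B : Matrix R R ℝ) (l : R → ℝ) :
    Differentiable ℂ (FF B l) := by
  unfold FF
  fun_prop

lemma FF_step {R : Type*} [Fintype R] [DecidableEq R] (B : Matrix R R ℝ) (l : R → ℝ)
    (a : R → ℝ) (x : R) (c : ℝ) :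
    ∫ θ in Set.univ.pi (fun _ : R => Set.Icc (0:ℝ) (2 * Real.pi)),
      FF B l (fun i => (θ i : ℂ) + a i * Complex.I) =
    ∫ θ in Set.univ.pi (fun _ : R => Set.Icc (0:ℝ) (2 * Real.pi)),
      FF B l (fun i => (θ i : ℂ) + (Function.update a x c) i * Complex.I) := by
  have hc := (FF_diff B l).continuous
  refine integral_pi_congr_coord _ _ (hc.comp (by fun_prop)) (hc.comp (by fun_prop)) x ?_
  intro θ
  set w : R → ℂ := fun i => (θ i : ℂ) + a i * Complex.I
  have hd : Differentiable ℂ (fun z : ℂ => FF B l (Function.update w x z)) := by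
    refine (FF_diff B l).comp ?_
    rw [differentiable_pi]
    intro i
    by_cases hi : i = x
    · subst hi; simp
    · simp [hi]
  have hp : ∀ z : ℂ, FF B l (Function.update w x (z + (2 * Real.pi : ℝ))) =
      FF B l (Function.update w x z) := by
    intro z
    have e : ∀ i, Complex.exp (Complex.I * Function.update w x (z + (2 * Real.pi : ℝ)) i) =
        Complex.exp (Complex.I * Function.update w x z i) := by
      intro i
      by_cases hi : i = x
      · subst hi
        simp only [Function.update_self]
        rw [← Complex.exp_periodic (Complex.I * z)]
        congr 1
        push_cast
        ring
      · simp [hi]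
    unfold FF
    simp only [mul_sub, Complex.exp_sub, e]
  have := contour_shift _ hd hp (a x) c
  convert this using 4 with t t
  all_goals
    ext i
    by_cases hi : i = x
    · subst hi; simp
    · simp [hi, w]

lemma FF_shift {R : Type*} [Fintype R] [DecidableEq R] (B : Matrix R R ℝ) (l : R → ℝ)
    (a : R → ℝ) (s : Finset R) :
    ∫ θ in Set.univ.pi (fun _ : R => Set.Icc (0:ℝ) (2 * Real.pi)),
      FF B l (fun i => (θ i : ℂ) + ((0 : ℝ) : ℂ) * Complex.I) =
    ∫ θ in Set.univ.pi (fun _ : R => Set.Icc (0:ℝ) (2 * Real.pi)),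
      FF B l (fun i => (θ i : ℂ) + ((if i ∈ s then a i else 0 : ℝ) : ℂ) * Complex.I) := by
  induction s using Finset.induction_on with
  | empty => simp
  | insert x s hx ih =>
    rw [ih, FF_step B l (fun i => if i ∈ s then a i else 0) x (a x)]
    congr 1
    ext θ
    congr 1
    ext i
    by_cases hi : i = x
    · subst hi; simp
    · simp [hi]

/-- **Contour-deformation invariance ((2.37) in the proof of Proposition 2.5).** For any
real matrix `B`, any `l ∈ (0,∞)^R` and any `r ∈ (0,∞)^R`,
`∫_{[0,2π]^R} e^{Σ B_{x,y}√(l_x l_y) e^{i(θ_x−θ_y)}} ∏ dθ/(2π)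
 = ∫_{[0,2π]^R} e^{Σ r_x B_{x,y} r_y⁻¹ √(l_x l_y) e^{i(θ_x−θ_y)}} ∏ dθ/(2π)`,
i.e. `G_B(l) = G_{B^{(r)}}(l)` with `B^{(r)}_{x,y} = r_x B_{x,y} r_y⁻¹`. -/
theorem GM_conjugation_invariant
    {R : Type*} [Fintype R] [DecidableEq R]
    (B : Matrix R R ℝ) (l r : R → ℝ) (hl : ∀ x, 0 < l x) (hr : ∀ x, 0 < r x) :
    GM B l = GM (Matrix.of fun x y => r x * B x y * (r y)⁻¹) l := by
  have h := FF_shift B l (fun i => -Real.log (r i)) Finset.univ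
  unfold GM
  congr 1
  simp only [Finset.mem_univ, if_true, Complex.ofReal_zero, zero_mul, add_zero] at h
  refine Eq.trans h ?_
  congr 1
  ext θ
  unfold FF
  congr 1
  refine Finset.sum_congr rfl fun x _ => Finset.sum_congr rfl fun y _ => ?_
  have e : Complex.I * ((θ x : ℂ) + ((-Real.log (r x) : ℝ) : ℂ) * Complex.I -
      ((θ y : ℂ) + ((-Real.log (r y) : ℝ) : ℂ) * Complex.I)) =
      ((Real.log (r x) : ℝ) : ℂ) + -((Real.log (r y) : ℝ) : ℂ) +
        Complex.I * ((θ x : ℂ) - (θ y : ℂ)) := by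
    push_cast
    linear_combination (-(Real.log (r x) : ℂ) + (Real.log (r y) : ℂ)) * Complex.I_sq
  rw [e, Complex.exp_add, Complex.exp_add, Complex.exp_neg, ← Complex.ofReal_exp,
    ← Complex.ofReal_exp, Real.exp_log (hr x), Real.exp_log (hr y), Matrix.of_apply]
  push_cast
  ring

end
end
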